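/- Fix a constant δ with 0 < δ < 1/4 and constants D₀,…,D₃ > 0. There exists C = C(δ, D₀,…,D₃) > 0 such that for every integer k ≥ 1 with 𝐤 := 4k − 1, every real r with 𝐤^{1/2−δ} < r ≤ 𝐤/4, and every cutoff β of width η = k^{−1/2−2δ} (with constants D₀,…,D₃), the oscillatory integral I := ∫₀^{π/2} β(x) (sin 2x)^{−1/2} exp(i𝐤(−x + (2r/𝐤) log(tan x))) dx satisfies |I| ≤ C [ 𝐤^{−1/3} · min(1, (1 − 4r/𝐤)^{−1/4} 𝐤^{−1/6}) + (r𝐤)^{−1/2} ], where the minimum is interpreted as 1 when 4r = 𝐤. -/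

import Mathlib

open MeasureTheory Set

noncomputable section

/-- The vertical line integral `(1/(2πi)) ∫_{Re w = Δ} F(w) dw`, parametrised
as `w = Δ + i t`, `t : ℝ` (so that `dw = i dt` and the prefactor becomes `(2π)⁻¹`). -/
def VI (Δ : ℝ) (F : ℂ → ℂ) : ℂ :=
  (2 * Real.pi)⁻¹ • ∫ t : ℝ, F ((Δ : ℂ) + (t : ℂ) * Complex.I)

/-- `I_{2k}(u; x)`, with the contour at `Re w = Δ`. -/
def Ifun (k : ℕ) (u : ℂ) (Δ : ℝ) (x : ℝ) : ℂ :=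
  VI Δ fun w =>
    Complex.Gamma (2 * (k : ℂ) - 1 / 2 + w / 2) /
        Complex.Gamma (2 * (k : ℂ) + 1 / 2 - w / 2) *
      Complex.Gamma (1 / 2 - u - w) *
      Complex.sin ((Real.pi : ℂ) * (1 / 2 + u + w) / 2) * (x : ℂ) ^ w

/-- `f_{2k}(u,v;x)` (the contour defining the inner `I_{2k}` is at `Re w = Δ`). -/
def ffun (k : ℕ) (u v : ℂ) (Δ : ℝ) (x : ℝ) : ℂ :=
  if x < 1 then
    (x : ℂ) ^ (1 / 2 + v) * ((1 : ℂ) - (x : ℂ)) ^ (-(1 / 2 + v)) *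
      Ifun k u Δ (2 / Real.sqrt (1 - x))
  else 0

/-- `g_{2k}(u,v;x)` (the contour defining the inner `I_{2k}` is at `Re w = Δ`). -/
def gfun (k : ℕ) (u v : ℂ) (Δ : ℝ) (x : ℝ) : ℂ :=
  (x : ℂ) ^ (1 / 2 + v) * ((1 : ℂ) + (x : ℂ)) ^ (-(1 / 2 + v)) *
    Ifun k u Δ (2 / Real.sqrt (1 + x))

/-- The Pochhammer symbol `(a)_n`. -/
def poch (a : ℂ) (n : ℕ) : ℂ := Polynomial.eval a (ascPochhammer ℂ n)

/-- The Gauss hypergeometric series `₂F₁(a,b;c;x)`. -/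
def hyp2F1 (a b c x : ℂ) : ℂ :=
  ∑' n : ℕ, poch a n * poch b n / (poch c n * (n.factorial : ℂ)) * x ^ n

/-- The hypergeometric series `₃F₂(a₁,a₂,a₃;b₁,b₂;1)`. -/
def hyp3F2 (a1 a2 a3 b1 b2 : ℂ) : ℂ :=
  ∑' n : ℕ,
    poch a1 n * poch a2 n * poch a3 n / (poch b1 n * poch b2 n * (n.factorial : ℂ))

/-- `Ψ_{2k}(u;x)`. -/
def PsiF (k : ℕ) (u x : ℂ) : ℂ :=
  x ^ (2 * (k : ℂ)) *
    (Complex.Gamma (2 * (k : ℂ) - 1 / 4 - u / 2) *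
        Complex.Gamma (2 * (k : ℂ) + 1 / 4 - u / 2) / Complex.Gamma (4 * (k : ℂ))) *
    hyp2F1 (2 * (k : ℂ) - 1 / 4 - u / 2) (2 * (k : ℂ) + 1 / 4 - u / 2) (4 * (k : ℂ)) x

/-- `Φ_{2k}(u;x)`. -/
def PhiF (k : ℕ) (u x : ℂ) : ℂ :=
  Complex.Gamma (2 * (k : ℂ) - 1 / 4 - u / 2) *
      Complex.Gamma (3 / 4 - 2 * (k : ℂ) - u / 2) / Complex.Gamma (1 / 2) *
    hyp2F1 (2 * (k : ℂ) - 1 / 4 - u / 2) (3 / 4 - 2 * (k : ℂ) - u / 2) (1 / 2) x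

/-- The number of `t` with `1 ≤ t ≤ 2q` and `t² ≡ n (mod 4q)`. -/
def sqCount (n : ℤ) (q : ℕ) : ℕ :=
  ((Finset.Icc 1 (2 * q)).filter fun t : ℕ => ((t : ℤ) ^ 2 - n) % (4 * q) = 0).card

/-- A smooth cutoff of width `η`, with derivative constants `D₀,…,D₃`. -/
def IsCutoff (D : Fin 4 → ℝ) (η : ℝ) (β : ℝ → ℝ) : Prop :=
  0 < η ∧ η < Real.pi / 8 ∧ ContDiffOn ℝ 3 β (Icc 0 (Real.pi / 2)) ∧
    (∀ x ∈ Icc (0 : ℝ) (Real.pi / 2), β x ∈ Icc (0 : ℝ) 1) ∧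
    (∀ x ∈ Icc (0 : ℝ) η, β x = 0) ∧
    (∀ x ∈ Icc (Real.pi / 2 - η) (Real.pi / 2), β x = 0) ∧
    (∀ x ∈ Icc (2 * η) (Real.pi / 2 - 2 * η), β x = 1) ∧
    ∀ j : Fin 4, ∀ x ∈ Icc (0 : ℝ) (Real.pi / 2),
      |iteratedDerivWithin (j : ℕ) β (Icc 0 (Real.pi / 2)) x| ≤ D j / η ^ (j : ℕ)

/-- First-derivative test: an amplitude `b * F * φ'` with `F` monotone and bounded by `M`, and `b`
bounded by one and of total variation at most `V`. -/
theorem norm_integral_mul_exp_le_of_monotone {p q M V : ℝ} (hpq : p ≤ q)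
    {b b' F F' φ φ' : ℝ → ℝ}
    (hb : ∀ x ∈ Icc p q, HasDerivAt b (b' x) x)
    (hF : ∀ x ∈ Icc p q, HasDerivAt F (F' x) x)
    (hφ : ∀ x ∈ Icc p q, HasDerivAt φ (φ' x) x)
    (hb' : ContinuousOn b' (Icc p q)) (hF' : ContinuousOn F' (Icc p q))
    (hφ' : ContinuousOn φ' (Icc p q))
    (hFnn : ∀ x ∈ Icc p q, 0 ≤ F' x) (hb1 : ∀ x ∈ Icc p q, |b x| ≤ 1)
    (hFM : ∀ x ∈ Icc p q, |F x| ≤ M) (hV : ∫ x in p..q, |b' x| ≤ V) :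
    ‖∫ x in p..q, ((b x * (F x * φ' x) : ℝ) : ℂ) *
      Complex.exp (Complex.I * ((φ x : ℝ) : ℂ))‖ ≤ (4 + V) * M := by
  have hu : uIcc p q = Icc p q := uIcc_of_le hpq
  have hp : p ∈ Icc p q := left_mem_Icc.2 hpq
  have hq : q ∈ Icc p q := right_mem_Icc.2 hpq
  have hM : 0 ≤ M := (abs_nonneg _).trans (hFM p hp)
  have cb : ContinuousOn b (Icc p q) := fun x hx => (hb x hx).continuousAt.continuousWithinAt
  have cF : ContinuousOn F (Icc p q) := fun x hx => (hF x hx).continuousAt.continuousWithinAt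
  have cφ : ContinuousOn φ (Icc p q) := fun x hx => (hφ x hx).continuousAt.continuousWithinAt
  set E : ℝ → ℂ := fun x => Complex.exp (Complex.I * ((φ x : ℝ) : ℂ)) with hE
  have hEn : ∀ x, ‖E x‖ = 1 := fun x => by
    rw [hE]; simp only [mul_comm Complex.I]; exact Complex.norm_exp_ofReal_mul_I _
  have cE : ContinuousOn E (Icc p q) := by
    apply Complex.continuous_exp.comp_continuousOn
    exact continuousOn_const.mul (Complex.continuous_ofReal.comp_continuousOn cφ)
  set u : ℝ → ℂ := fun x => ((b x * F x : ℝ) : ℂ)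
  set u' : ℝ → ℂ := fun x => ((b' x * F x + b x * F' x : ℝ) : ℂ)
  set v' : ℝ → ℂ := fun x => E x * (Complex.I * ((φ' x : ℝ) : ℂ))
  have du : ∀ x ∈ uIcc p q, HasDerivAt u (u' x) x := fun x hx => by
    rw [hu] at hx
    exact ((hb x hx).mul (hF x hx)).ofReal_comp
  have dE : ∀ x ∈ uIcc p q, HasDerivAt E (v' x) x := fun x hx => by
    rw [hu] at hx
    exact ((hφ x hx).ofReal_comp.const_mul Complex.I).cexp
  have cu' : ContinuousOn u' (uIcc p q) := by
    rw [hu]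
    exact Complex.continuous_ofReal.comp_continuousOn ((hb'.mul cF).add (cb.mul hF'))
  have cv' : ContinuousOn v' (uIcc p q) := by
    rw [hu]
    exact cE.mul (continuousOn_const.mul (Complex.continuous_ofReal.comp_continuousOn hφ'))
  have key := intervalIntegral.integral_mul_deriv_eq_deriv_mul du dE cu'.intervalIntegrable
    cv'.intervalIntegrable
  have e1 : ∫ x in p..q, u x * v' x = Complex.I * ∫ x in p..q,
      ((b x * (F x * φ' x) : ℝ) : ℂ) * E x := by
    rw [← intervalIntegral.integral_const_mul]
    congr 1; ext x; simp only [u, v']; push_cast; ring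
  have e2 : ‖∫ x in p..q, ((b x * (F x * φ' x) : ℝ) : ℂ) * E x‖ =
      ‖u q * E q - u p * E p - ∫ x in p..q, u' x * E x‖ := by
    rw [← key, e1, norm_mul, Complex.norm_I, one_mul]
  have hun : ∀ x ∈ Icc p q, ‖u x * E x‖ ≤ M := fun x hx => by
    rw [norm_mul, hEn, mul_one, Complex.norm_real, Real.norm_eq_abs, abs_mul]
    calc |b x| * |F x| ≤ 1 * M :=
          mul_le_mul (hb1 x hx) (hFM x hx) (abs_nonneg _) zero_le_one
      _ = M := one_mul M
  have iF' : IntervalIntegrable F' volume p q := by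
    apply ContinuousOn.intervalIntegrable; rwa [hu]
  have ib' : IntervalIntegrable (fun x => |b' x|) volume p q := by
    apply ContinuousOn.intervalIntegrable; rw [hu]; exact hb'.abs
  have hint : ‖∫ x in p..q, u' x * E x‖ ≤ M * V + 2 * M := by
    calc ‖∫ x in p..q, u' x * E x‖ ≤ ∫ x in p..q, (M * |b' x| + F' x) := by
          apply intervalIntegral.norm_integral_le_of_norm_le hpq
          · refine Filter.Eventually.of_forall fun x hx => ?_
            have hx := Ioc_subset_Icc_self hx
            rw [norm_mul, hEn, mul_one, Complex.norm_real, Real.norm_eq_abs]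
            refine (abs_add_le _ _).trans ?_
            rw [abs_mul, abs_mul, abs_of_nonneg (hFnn x hx), mul_comm M]
            exact add_le_add (mul_le_mul_of_nonneg_left (hFM x hx) (abs_nonneg _))
              (mul_le_of_le_one_left (hFnn x hx) (hb1 x hx))
          · exact (ib'.const_mul M).add iF'
      _ = M * (∫ x in p..q, |b' x|) + (F q - F p) := by
          rw [intervalIntegral.integral_add (ib'.const_mul M) iF',
            intervalIntegral.integral_const_mul,
            intervalIntegral.integral_eq_sub_of_hasDerivAt (fun x hx => hF x (hu ▸ hx)) iF']
      _ ≤ M * V + 2 * M := by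
          have h1 := (abs_le.1 (hFM p hp)).1
          have h2 := (abs_le.1 (hFM q hq)).2
          have := mul_le_mul_of_nonneg_left hV hM
          linarith
  rw [e2]
  calc _ ≤ ‖u q * E q‖ + ‖u p * E p‖ + ‖∫ x in p..q, u' x * E x‖ :=
        (norm_sub_le _ _).trans (add_le_add (norm_sub_le _ _) le_rfl)
    _ ≤ (4 + V) * M := by linarith [hun p hp, hun q hq]

/-- Lower bound for the distance of `sin (2x)` from its value at the saddle point. -/
theorem half_mul_abs_sub_le_abs_sin_sub {x ϑ m : ℝ} (hx0 : 0 ≤ x) (hx : x ≤ Real.pi / 4)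
    (hϑ0 : 0 ≤ ϑ) (hϑ : ϑ ≤ Real.pi / 4) (hm : 0 ≤ m) (hmx : m ≤ Real.pi / 2 - x - ϑ) :
    |x - ϑ| * m / 2 ≤ |Real.sin (2 * x) - Real.sin (2 * ϑ)| := by
  have hpi := Real.pi_pos
  have e : Real.sin (2 * x) - Real.sin (2 * ϑ) =
      2 * Real.sin (x - ϑ) * Real.cos (x + ϑ) := by
    rw [Real.sin_sub_sin]; ring_nf
  have habs : |x - ϑ| ≤ Real.pi / 4 := abs_le.2 ⟨by linarith, by linarith⟩
  have h1 : 2 / Real.pi * |x - ϑ| ≤ |Real.sin (x - ϑ)| := by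
    refine Real.mul_abs_le_abs_sin (by linarith)
  have h2 : 2 / Real.pi * m ≤ Real.cos (x + ϑ) := by
    rw [← Real.sin_pi_div_two_sub]
    refine le_trans ?_ (Real.mul_le_sin (by linarith) (by linarith))
    exact mul_le_mul_of_nonneg_left (by linarith) (by positivity)
  have h3 : (0 : ℝ) ≤ 2 / Real.pi * m := by positivity
  have h4 : (1 : ℝ) / 4 ≤ (2 / Real.pi) * (2 / Real.pi) := by
    have : (1 : ℝ) / 2 ≤ 2 / Real.pi := by
      rw [div_le_div_iff₀ (by norm_num) hpi]; linarith [Real.pi_le_four]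
    nlinarith
  rw [e, abs_mul, abs_mul, abs_of_nonneg (h3.trans h2), abs_two]
  have := mul_le_mul h1 h2 h3 (abs_nonneg _)
  have h5 := mul_le_mul_of_nonneg_right h4 (mul_nonneg (abs_nonneg (x - ϑ)) hm)
  nlinarith

theorem hasDerivAt_log_tan {x : ℝ} (hx : x ∈ Ioo 0 (Real.pi / 2)) :
    HasDerivAt (fun y => Real.log (Real.tan y)) (2 / Real.sin (2 * x)) x := by
  have hs : 0 < Real.sin x := Real.sin_pos_of_pos_of_lt_pi hx.1 (by linarith [hx.2, Real.pi_pos])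
  have hc : 0 < Real.cos x := Real.cos_pos_of_mem_Ioo ⟨by linarith [hx.1, Real.pi_pos], hx.2⟩
  have ht : Real.tan x ≠ 0 := by rw [Real.tan_eq_sin_div_cos]; positivity
  convert (Real.hasDerivAt_tan hc.ne').log ht using 1
  rw [Real.sin_two_mul, Real.tan_eq_sin_div_cos]
  field_simp

theorem hasDerivAt_sqrt_sin_div {x a K : ℝ} (hs : 0 < Real.sin (2 * x))
    (hne : a - K * Real.sin (2 * x) ≠ 0) :
    HasDerivAt (fun y => √(Real.sin (2 * y)) / (a - K * Real.sin (2 * y)))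
      (Real.cos (2 * x) * (a + K * Real.sin (2 * x)) /
        (√(Real.sin (2 * x)) * (a - K * Real.sin (2 * x)) ^ 2)) x := by
  have h1 : HasDerivAt (fun y => Real.sin (2 * y)) (Real.cos (2 * x) * 2) x := by
    simpa using ((hasDerivAt_id x).const_mul 2).sin
  refine ((h1.sqrt hs.ne').div ((h1.const_mul K).const_sub a) hne).congr_deriv ?_
  have hq : √(Real.sin (2 * x)) ≠ 0 := (Real.sqrt_pos.2 hs).ne'
  have hsq : Real.sin (2 * x) = √(Real.sin (2 * x)) ^ 2 := (Real.sq_sqrt hs.le).symm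
  generalize √(Real.sin (2 * x)) = t at *
  rw [hsq] at hne ⊢
  field_simp
  ring

/-- The integrand of the oscillatory integral, with cutoff `b`. -/
def oscIntegrand (K r : ℝ) (b : ℝ → ℝ) (x : ℝ) : ℂ :=
  ((b x / √(Real.sin (2 * x)) : ℝ) : ℂ) * Complex.exp (Complex.I *
    ((K * (-x + 2 * r / K * Real.log (Real.tan x)) : ℝ) : ℂ))

theorem norm_oscIntegrand (K r : ℝ) (b : ℝ → ℝ) (x : ℝ) :
    ‖oscIntegrand K r b x‖ = |b x| / √(Real.sin (2 * x)) := by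
  rw [oscIntegrand, norm_mul, mul_comm Complex.I, Complex.norm_exp_ofReal_mul_I, mul_one,
    Complex.norm_real, Real.norm_eq_abs, abs_div, abs_of_nonneg (Real.sqrt_nonneg _)]

theorem sqrt_sin_mul_le {x ϑ ρ : ℝ} (hx : 0 ≤ x) (hϑ : 0 ≤ ϑ) (hρ : 0 ≤ ρ) (hρϑ : ρ ≤ ϑ)
    (hd : ρ ≤ |x - ϑ|) : √(Real.sin (2 * x)) * ρ ≤ 2 * √ϑ * |x - ϑ| := by
  have h1 : Real.sin (2 * x) ≤ 2 * x := Real.sin_le (by linarith)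
  have h2 : √(Real.sin (2 * x)) ≤ √(2 * x) := Real.sqrt_le_sqrt h1
  refine (mul_le_mul_of_nonneg_right h2 hρ).trans ?_
  have hd0 := abs_nonneg (x - ϑ)
  have h3 : x ≤ ϑ + |x - ϑ| := by linarith [le_abs_self (x - ϑ)]
  refine abs_le_of_sq_le_sq' ?_ (by positivity) |>.2
  rw [mul_pow, mul_pow, mul_pow, Real.sq_sqrt (by linarith), Real.sq_sqrt hϑ]
  generalize |x - ϑ| = d at *
  have h4 : ρ ^ 2 ≤ d ^ 2 := pow_le_pow_left₀ hρ hd 2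
  have h5 : ρ ^ 2 ≤ ϑ * d := by nlinarith
  have h6 : x * ρ ^ 2 ≤ (ϑ + d) * ρ ^ 2 := mul_le_mul_of_nonneg_right h3 (sq_nonneg _)
  nlinarith [mul_le_mul_of_nonneg_left h4 hϑ, mul_le_mul_of_nonneg_left h5 hd0]

theorem norm_integral_oscIntegrand_le_of_dist {K r ϑ ρ m V p q : ℝ} {b b' : ℝ → ℝ}
    (hK : 0 < K) (hϑ0 : 0 < ϑ) (hϑ : ϑ ≤ Real.pi / 4) (hr : 4 * r = K * Real.sin (2 * ϑ))
    (hρ : 0 < ρ) (hρϑ : ρ ≤ ϑ) (hm : 0 < m)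
    (hp : 0 < p) (hpq : p ≤ q) (hq : q ≤ Real.pi / 4)
    (hd : ∀ x ∈ Icc p q, ρ ≤ |x - ϑ|) (hmx : m ≤ Real.pi / 2 - q - ϑ)
    (hb : ∀ x ∈ Icc p q, HasDerivAt b (b' x) x) (hb' : ContinuousOn b' (Icc p q))
    (hb1 : ∀ x ∈ Icc p q, |b x| ≤ 1) (hV : ∫ x in p..q, |b' x| ≤ V) :
    ‖∫ x in p..q, oscIntegrand K r b x‖ ≤ (4 + V) * (4 * √ϑ / (K * ρ * m)) := by
  have hpi := Real.pi_pos
  have hmem : ∀ x ∈ Icc p q, 0 < x ∧ x ≤ Real.pi / 4 := fun x hx =>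
    ⟨hp.trans_le hx.1, hx.2.trans hq⟩
  have hs : ∀ x ∈ Icc p q, 0 < Real.sin (2 * x) := fun x hx =>
    Real.sin_pos_of_pos_of_lt_pi (by linarith [(hmem x hx).1]) (by linarith [(hmem x hx).2])
  have hden : ∀ x ∈ Icc p q, K * (|x - ϑ| * m / 2) ≤ |4 * r - K * Real.sin (2 * x)| := by
    intro x hx
    rw [hr, ← mul_sub, abs_mul, abs_of_pos hK, abs_sub_comm (Real.sin _)]
    exact mul_le_mul_of_nonneg_left (half_mul_abs_sub_le_abs_sin_sub (hmem x hx).1.le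
      (hmem x hx).2 hϑ0.le hϑ hm.le (by linarith [hx.2])) hK.le
  have hdpos : ∀ x ∈ Icc p q, 0 < |x - ϑ| := fun x hx => hρ.trans_le (hd x hx)
  have hne : ∀ x ∈ Icc p q, 4 * r - K * Real.sin (2 * x) ≠ 0 := fun x hx => by
    have := hdpos x hx
    exact abs_pos.1 (lt_of_lt_of_le (by positivity) (hden x hx))
  have hr0 : 0 ≤ 4 * r := by
    rw [hr]
    exact mul_nonneg hK.le (Real.sin_nonneg_of_nonneg_of_le_pi (by linarith) (by linarith))
  have csin : ContinuousOn (fun x => Real.sin (2 * x)) (Icc p q) := by fun_prop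
  have main := norm_integral_mul_exp_le_of_monotone (M := 4 * √ϑ / (K * ρ * m)) (V := V)
    (F := fun y => √(Real.sin (2 * y)) / (4 * r - K * Real.sin (2 * y)))
    (F' := fun x => Real.cos (2 * x) * (4 * r + K * Real.sin (2 * x)) /
        (√(Real.sin (2 * x)) * (4 * r - K * Real.sin (2 * x)) ^ 2))
    (φ := fun x => K * (-x + 2 * r / K * Real.log (Real.tan x)))
    (φ' := fun x => K * (-1 + 2 * r / K * (2 / Real.sin (2 * x)))) hpq hb
    (fun x hx => hasDerivAt_sqrt_sin_div (hs x hx) (hne x hx))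
    (fun x hx => ((hasDerivAt_neg x).add ((hasDerivAt_log_tan
      ⟨(hmem x hx).1, by linarith [(hmem x hx).2]⟩).const_mul _)).const_mul K) hb'
    (by
      apply ContinuousOn.div (by fun_prop) (by fun_prop)
      intro x hx
      exact mul_ne_zero (Real.sqrt_pos.2 (hs x hx)).ne' (pow_ne_zero _ (hne x hx)))
    (by
      refine continuousOn_const.mul (continuousOn_const.add (continuousOn_const.mul ?_))
      exact continuousOn_const.div csin fun x hx => (hs x hx).ne')
    (by
      intro x hx
      have hc : 0 ≤ Real.cos (2 * x) := Real.cos_nonneg_of_neg_pi_div_two_le_of_le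
        (by linarith [(hmem x hx).1]) (by linarith [(hmem x hx).2])
      have := (hs x hx).le
      positivity)
    hb1
    (by
      intro x hx
      have h1 := sqrt_sin_mul_le (hmem x hx).1.le hϑ0.le hρ.le hρϑ (hd x hx)
      have h2 := hden x hx
      have h3 := hdpos x hx
      rw [abs_div, abs_of_nonneg (Real.sqrt_nonneg _)]
      rw [div_le_div_iff₀ (abs_pos.2 (hne x hx)) (by positivity)]
      calc √(Real.sin (2 * x)) * (K * ρ * m) = √(Real.sin (2 * x)) * ρ * (K * m) := by ring
        _ ≤ 2 * √ϑ * |x - ϑ| * (K * m) := mul_le_mul_of_nonneg_right h1 (by positivity)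
        _ = 4 * √ϑ * (K * (|x - ϑ| * m / 2)) := by ring
        _ ≤ _ := mul_le_mul_of_nonneg_left h2 (by positivity))
    hV
  refine le_of_eq_of_le (congrArg norm (intervalIntegral.integral_congr fun x hx => ?_)) main
  rw [uIcc_of_le hpq] at hx
  have hsx := hs x hx
  have hnx := hne x hx
  simp only [oscIntegrand]
  congr 2
  have hq : √(Real.sin (2 * x)) ≠ 0 := (Real.sqrt_pos.2 hsx).ne'
  have hsq : Real.sin (2 * x) = √(Real.sin (2 * x)) ^ 2 := (Real.sq_sqrt hsx.le).symm
  generalize √(Real.sin (2 * x)) = t at *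
  rw [hsq] at hnx ⊢
  have e : K * (-1 + 2 * r / K * (2 / t ^ 2)) = (4 * r - K * t ^ 2) / t ^ 2 := by
    field_simp
    ring
  rw [e]
  generalize 4 * r - K * t ^ 2 = d at *
  field_simp

/-- Estimate of the oscillatory integral over the half interval containing the saddle point `ϑ`,
with a neighbourhood of radius `ρ` of the saddle point estimated trivially. -/
theorem norm_half_integral_oscIntegrand_le {K r ϑ ρ m V η : ℝ} {b b' : ℝ → ℝ}
    (hK : 0 < K) (hϑ0 : 0 < ϑ) (hϑ : ϑ ≤ Real.pi / 4) (hr : 4 * r = K * Real.sin (2 * ϑ))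
    (hρ : 0 < ρ) (hρϑ : ρ ≤ ϑ / 2) (hm : 0 < m) (hmax : m ≤ max (Real.pi / 4 - ϑ) ρ)
    (hη : 0 < η) (hb : ∀ x ∈ Ioo 0 (Real.pi / 2), HasDerivAt b (b' x) x)
    (hb' : ContinuousOn b' (Icc 0 (Real.pi / 4)))
    (hb1 : ∀ x ∈ Icc 0 (Real.pi / 4), |b x| ≤ 1) (hb0 : ∀ x ∈ Icc 0 η, b x = 0)
    (hV : ∫ x in (0 : ℝ)..(Real.pi / 4), |b' x| ≤ V)
    (hint : IntervalIntegrable (oscIntegrand K r b) volume 0 (Real.pi / 4)) :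
    ‖∫ x in (0 : ℝ)..(Real.pi / 4), oscIntegrand K r b x‖ ≤
      3 * ρ / √ϑ + 2 * ((4 + V) * (4 * √ϑ / (K * ρ * m))) := by
  have hpi := Real.pi_pos
  have hsub : ∀ {p q : ℝ}, 0 ≤ p → p ≤ q → q ≤ Real.pi / 4 → uIcc p q ⊆ uIcc 0 (Real.pi / 4) := by
    intro p q h1 h2 h3
    rw [uIcc_of_le h2, uIcc_of_le (by linarith)]
    exact Icc_subset_Icc h1 h3
  have hI : ∀ {p q : ℝ}, 0 ≤ p → p ≤ q → q ≤ Real.pi / 4 →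
      IntervalIntegrable (oscIntegrand K r b) volume p q := fun h1 h2 h3 =>
    hint.mono_set (hsub h1 h2 h3)
  have hV' : ∀ {p q : ℝ}, 0 ≤ p → p ≤ q → q ≤ Real.pi / 4 → ∫ x in p..q, |b' x| ≤ V := by
    intro p q h1 h2 h3
    refine (intervalIntegral.integral_mono_interval h1 h2 h3
      (Filter.Eventually.of_forall fun x => abs_nonneg _) ?_).trans hV
    apply ContinuousOn.intervalIntegrable
    rw [uIcc_of_le (by linarith)]
    exact hb'.abs
  have hV0 : 0 ≤ V := by simpa using hV' le_rfl le_rfl (by linarith : (0 : ℝ) ≤ Real.pi / 4)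
  have hseg : ∀ {p q : ℝ}, 0 < p → p ≤ q → q ≤ Real.pi / 4 → (∀ x ∈ Icc p q, ρ ≤ |x - ϑ|) →
      m ≤ Real.pi / 2 - q - ϑ →
      ‖∫ x in p..q, oscIntegrand K r b x‖ ≤ (4 + V) * (4 * √ϑ / (K * ρ * m)) := by
    intro p q h1 h2 h3 h4 h5
    exact norm_integral_oscIntegrand_le_of_dist hK hϑ0 hϑ hr hρ (by linarith) hm h1 h2 h3 h4 h5
      (fun x hx => hb x ⟨by linarith [hx.1], by linarith [hx.2]⟩)
      (hb'.mono (Icc_subset_Icc h1.le h3))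
      (fun x hx => hb1 x ⟨by linarith [hx.1], by linarith [hx.2]⟩) (hV' h1.le h2 h3)
  have hB : 0 ≤ (4 + V) * (4 * √ϑ / (K * ρ * m)) := by positivity
  set B := (4 + V) * (4 * √ϑ / (K * ρ * m))
  have hleft : ‖∫ x in (0 : ℝ)..(ϑ - ρ), oscIntegrand K r b x‖ ≤ B := by
    have h0 : 0 < min η (ϑ - ρ) := lt_min hη (by linarith)
    have hle := min_le_right η (ϑ - ρ)
    rw [← intervalIntegral.integral_add_adjacent_intervals (hI le_rfl h0.le (by linarith))
      (hI h0.le hle (by linarith))]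
    have z : ∫ x in (0 : ℝ)..(min η (ϑ - ρ)), oscIntegrand K r b x = 0 := by
      rw [intervalIntegral.integral_congr (g := fun _ => (0 : ℂ))]
      · simp
      · intro x hx
        rw [uIcc_of_le h0.le] at hx
        simp [oscIntegrand, hb0 x ⟨hx.1, hx.2.trans (min_le_left _ _)⟩]
    rw [z, zero_add]
    refine hseg h0 hle (by linarith) (fun x hx => ?_) (hmax.trans (max_le ?_ ?_))
    · rw [abs_sub_comm]; exact le_trans (by linarith [hx.2]) (le_abs_self _)
    · linarith
    · linarith
  set x₂ := min (ϑ + ρ) (Real.pi / 4) with hx₂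
  have hx₂le : x₂ ≤ Real.pi / 4 := min_le_right _ _
  have hx₂ge : ϑ ≤ x₂ := le_min (by linarith) hϑ
  have hright : ‖∫ x in x₂..(Real.pi / 4), oscIntegrand K r b x‖ ≤ B := by
    rcases le_total (Real.pi / 4) (ϑ + ρ) with h | h
    · rw [hx₂, min_eq_right h]; simpa using hB
    · have e : x₂ = ϑ + ρ := min_eq_left h
      refine hseg (by linarith) hx₂le le_rfl (fun x hx => ?_) (hmax.trans (max_le ?_ ?_))
      · exact le_trans (by linarith [hx.1]) (le_abs_self _)
      · linarith
      · linarith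
  have hmid : ‖∫ x in (ϑ - ρ)..x₂, oscIntegrand K r b x‖ ≤ 3 * ρ / √ϑ := by
    have hsϑ : 0 < √ϑ := Real.sqrt_pos.2 hϑ0
    have hbd : ∀ x ∈ uIoc (ϑ - ρ) x₂, ‖oscIntegrand K r b x‖ ≤ 3 / 2 / √ϑ := by
      intro x hx
      rw [uIoc_of_le (by linarith)] at hx
      have hx1 : ϑ / 2 ≤ x := by linarith [hx.1]
      have hx2 : x ≤ Real.pi / 4 := hx.2.trans hx₂le
      have hs : x ≤ Real.sin (2 * x) := by
        refine le_trans ?_ (Real.mul_le_sin (by linarith) (by linarith))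
        rw [← mul_assoc]
        refine le_mul_of_one_le_left (by linarith) ?_
        rw [div_mul_eq_mul_div, le_div_iff₀ hpi]
        linarith [Real.pi_le_four]
      rw [norm_oscIntegrand, div_le_div_iff₀ (Real.sqrt_pos.2 (by linarith)) hsϑ]
      have h1 : √ϑ ≤ 3 / 2 * √(Real.sin (2 * x)) := by
        rw [show (3 / 2 : ℝ) = √(9 / 4) by
          rw [show (9 / 4 : ℝ) = (3 / 2) ^ 2 by norm_num, Real.sqrt_sq (by norm_num)],
          ← Real.sqrt_mul (by norm_num)]
        exact Real.sqrt_le_sqrt (by linarith)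
      exact (mul_le_of_le_one_left hsϑ.le (hb1 x ⟨by linarith, hx2⟩)).trans h1
    refine (intervalIntegral.norm_integral_le_of_norm_le_const hbd).trans ?_
    rw [abs_of_nonneg (by linarith)]
    have : x₂ ≤ ϑ + ρ := min_le_left _ _
    calc 3 / 2 / √ϑ * (x₂ - (ϑ - ρ)) ≤ 3 / 2 / √ϑ * (2 * ρ) :=
          mul_le_mul_of_nonneg_left (by linarith) (by positivity)
      _ = 3 * ρ / √ϑ := by ring
  rw [← intervalIntegral.integral_add_adjacent_intervals (b := ϑ - ρ)
      (hI le_rfl (by linarith) (by linarith)) (hI (by linarith) (by linarith) le_rfl),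
    ← intervalIntegral.integral_add_adjacent_intervals (b := x₂)
      (hI (by linarith) (by linarith) hx₂le) (hI (by linarith) hx₂le le_rfl)]
  have := norm_add₃_le (a := ∫ x in (0 : ℝ)..(ϑ - ρ), oscIntegrand K r b x)
    (b := ∫ x in (ϑ - ρ)..x₂, oscIntegrand K r b x)
    (c := ∫ x in x₂..(Real.pi / 4), oscIntegrand K r b x)
  rw [← add_assoc]
  linarith

theorem intervalIntegrable_oscIntegrand {K r η : ℝ} {b : ℝ → ℝ} (hη : 0 < η)
    (hη' : η ≤ Real.pi / 4)
    (hb : ContinuousOn b (Icc 0 (Real.pi / 2))) (hb0 : ∀ x ∈ Icc 0 η, b x = 0)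
    (hb1 : ∀ x ∈ Icc (Real.pi / 2 - η) (Real.pi / 2), b x = 0) :
    IntervalIntegrable (oscIntegrand K r b) volume 0 (Real.pi / 2) := by
  have hpi := Real.pi_pos
  have hzero : ∀ {p q : ℝ}, p ≤ q → (∀ x ∈ Icc p q, b x = 0) →
      IntervalIntegrable (oscIntegrand K r b) volume p q := by
    intro p q hpq h
    refine IntervalIntegrable.congr (f := fun _ => (0 : ℂ)) (fun x hx => ?_)
      intervalIntegrable_const
    rw [uIoc_of_le hpq] at hx
    simp [oscIntegrand, h x (Ioc_subset_Icc_self hx)]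
  refine ((hzero hη.le hb0).trans (b := η) ?_).trans (b := Real.pi / 2 - η)
    (hzero (by linarith) hb1)
  apply ContinuousOn.intervalIntegrable
  rw [uIcc_of_le (by linarith)]
  have hmem : ∀ x ∈ Icc η (Real.pi / 2 - η), x ∈ Ioo 0 (Real.pi / 2) := fun x hx =>
    ⟨by linarith [hx.1], by linarith [hx.2]⟩
  have hs : ∀ x ∈ Icc η (Real.pi / 2 - η), 0 < Real.sin (2 * x) := fun x hx =>
    Real.sin_pos_of_pos_of_lt_pi (by linarith [(hmem x hx).1]) (by linarith [(hmem x hx).2])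
  have c1 : ContinuousOn (fun x => Real.log (Real.tan x)) (Icc η (Real.pi / 2 - η)) := fun x hx =>
    (hasDerivAt_log_tan (hmem x hx)).continuousAt.continuousWithinAt
  have c2 : ContinuousOn b (Icc η (Real.pi / 2 - η)) :=
    hb.mono (Icc_subset_Icc hη.le (by linarith))
  have c3 : ContinuousOn (fun x => b x / √(Real.sin (2 * x))) (Icc η (Real.pi / 2 - η)) :=
    c2.div (by fun_prop) fun x hx => (Real.sqrt_pos.2 (hs x hx)).ne'
  refine (Complex.continuous_ofReal.comp_continuousOn c3).mul
    (Complex.continuous_exp.comp_continuousOn (continuousOn_const.mul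
      (Complex.continuous_ofReal.comp_continuousOn ?_)))
  fun_prop

theorem oscIntegrand_pi_div_two_sub (K r : ℝ) (b : ℝ → ℝ) (x : ℝ) :
    oscIntegrand K r b (Real.pi / 2 - x) =
      Complex.exp (((-(K * Real.pi / 2) : ℝ) : ℂ) * Complex.I) *
        (starRingEnd ℂ) (oscIntegrand K r (fun y => b (Real.pi / 2 - y)) x) := by
  simp only [oscIntegrand, map_mul, Complex.conj_ofReal, ← Complex.exp_conj, Complex.conj_I]
  rw [mul_left_comm, ← Complex.exp_add, Real.tan_pi_div_two_sub, Real.log_inv,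
    show 2 * (Real.pi / 2 - x) = Real.pi - 2 * x by ring, Real.sin_pi_sub]
  congr 2
  push_cast
  ring

theorem norm_integral_right_half_oscIntegrand (K r : ℝ) (b : ℝ → ℝ) :
    ‖∫ x in (Real.pi / 4)..(Real.pi / 2), oscIntegrand K r b x‖ =
      ‖∫ x in (0 : ℝ)..(Real.pi / 4), oscIntegrand K r (fun y => b (Real.pi / 2 - y)) x‖ := by
  have h := intervalIntegral.integral_comp_sub_left (a := 0) (b := Real.pi / 4)
    (oscIntegrand K r b) (Real.pi / 2)
  rw [show Real.pi / 2 - Real.pi / 4 = Real.pi / 4 by ring, sub_zero] at h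
  rw [← h]
  simp only [oscIntegrand_pi_div_two_sub]
  rw [intervalIntegral.integral_const_mul, intervalIntegral.intervalIntegral_conj, norm_mul,
    Complex.norm_exp_ofReal_mul_I, one_mul, RCLike.norm_conj]

theorem integral_abs_le_of_eq_zero {a c d M : ℝ} {g : ℝ → ℝ} (hac : a ≤ c) (hcd : c ≤ d)
    (hg : ContinuousOn g (Icc a d)) (hM : ∀ x ∈ Icc a c, |g x| ≤ M)
    (h0 : ∀ x ∈ Icc c d, g x = 0) : ∫ x in a..d, |g x| ≤ M * (c - a) := by
  have i1 : IntervalIntegrable (fun x => |g x|) volume a c := by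
    apply ContinuousOn.intervalIntegrable
    rw [uIcc_of_le hac]
    exact (hg.mono (Icc_subset_Icc le_rfl hcd)).abs
  have i2 : IntervalIntegrable (fun x => |g x|) volume c d := by
    apply ContinuousOn.intervalIntegrable
    rw [uIcc_of_le hcd]
    exact (hg.mono (Icc_subset_Icc hac le_rfl)).abs
  have z : ∫ x in c..d, |g x| = 0 := by
    rw [intervalIntegral.integral_congr (g := fun _ => (0 : ℝ))]
    · simp
    · intro x hx
      rw [uIcc_of_le hcd] at hx
      simp [h0 x hx]
  rw [← intervalIntegral.integral_add_adjacent_intervals i1 i2, z, add_zero]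
  calc ∫ x in a..c, |g x| ≤ ∫ _ in a..c, M :=
        intervalIntegral.integral_mono_on hac i1 intervalIntegrable_const hM
    _ = M * (c - a) := by simp [mul_comm]

theorem IsCutoff.exists_deriv {D : Fin 4 → ℝ} {η : ℝ} {β : ℝ → ℝ} (h : IsCutoff D η β) :
    ∃ β' : ℝ → ℝ, (∀ x ∈ Ioo 0 (Real.pi / 2), HasDerivAt β (β' x) x) ∧
      ContinuousOn β' (Icc 0 (Real.pi / 2)) ∧
      ∫ x in (0 : ℝ)..(Real.pi / 4), |β' x| ≤ 2 * D 1 ∧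
      ∫ x in (0 : ℝ)..(Real.pi / 4), |β' (Real.pi / 2 - x)| ≤ 2 * D 1 := by
  obtain ⟨hη, hη8, hC, -, -, -, hone, hD⟩ := h
  have hpi := Real.pi_pos
  have hud : UniqueDiffOn ℝ (Icc 0 (Real.pi / 2)) := uniqueDiffOn_Icc (by linarith)
  have hcont : ContinuousOn (derivWithin β (Icc 0 (Real.pi / 2))) (Icc 0 (Real.pi / 2)) :=
    hC.continuousOn_derivWithin hud (by norm_num)
  have hdw : ∀ x ∈ Icc 0 (Real.pi / 2), HasDerivWithinAt β
      (derivWithin β (Icc 0 (Real.pi / 2)) x) (Icc 0 (Real.pi / 2)) x := fun x hx =>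
    (hC.differentiableOn (by norm_num) x hx).hasDerivWithinAt
  have hbd : ∀ x ∈ Icc 0 (Real.pi / 2),
      |derivWithin β (Icc 0 (Real.pi / 2)) x| ≤ D 1 / η := fun x hx => by
    simpa [iteratedDerivWithin_one] using hD 1 x hx
  have hzero : ∀ x ∈ Icc (2 * η) (Real.pi / 2 - 2 * η),
      derivWithin β (Icc 0 (Real.pi / 2)) x = 0 := by
    intro x hx
    have hsub : Icc (2 * η) (Real.pi / 2 - 2 * η) ⊆ Icc 0 (Real.pi / 2) :=
      Icc_subset_Icc (by linarith) (by linarith)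
    have hu : UniqueDiffWithinAt ℝ (Icc (2 * η) (Real.pi / 2 - 2 * η)) x :=
      uniqueDiffOn_Icc (by linarith) x hx
    exact hu.eq_deriv _ ((hdw x (hsub hx)).mono hsub)
      ((hasDerivWithinAt_const x _ (1 : ℝ)).congr hone (hone x hx))
  have hV : D 1 / η * (2 * η - 0) = 2 * D 1 := by field_simp; ring
  refine ⟨_, fun x hx => (hdw x (Ioo_subset_Icc_self hx)).hasDerivAt (Icc_mem_nhds hx.1 hx.2),
    hcont, ?_, ?_⟩
  · refine (integral_abs_le_of_eq_zero (c := 2 * η) (by linarith) (by linarith)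
      (hcont.mono (Icc_subset_Icc le_rfl (by linarith)))
      (fun x hx => hbd x ⟨hx.1, by linarith [hx.2]⟩)
      (fun x hx => hzero x ⟨hx.1, by linarith [hx.2]⟩)).trans_eq hV
  · refine (integral_abs_le_of_eq_zero (c := 2 * η)
      (g := fun x => derivWithin β (Icc 0 (Real.pi / 2)) (Real.pi / 2 - x))
      (by linarith) (by linarith) ?_
      (fun x hx => hbd _ ⟨by linarith [hx.2], by linarith [hx.1]⟩)
      (fun x hx => hzero _ ⟨by linarith [hx.2], by linarith [hx.1]⟩)).trans_eq hV
    exact hcont.comp (by fun_prop) fun x hx => ⟨by linarith [hx.2], by linarith [hx.1]⟩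

theorem IsCutoff.norm_integral_oscIntegrand_le {D : Fin 4 → ℝ} {η : ℝ} {β : ℝ → ℝ}
    (h : IsCutoff D η β) {K r ϑ ρ m : ℝ}
    (hK : 0 < K) (hϑ0 : 0 < ϑ) (hϑ : ϑ ≤ Real.pi / 4) (hr : 4 * r = K * Real.sin (2 * ϑ))
    (hρ : 0 < ρ) (hρϑ : ρ ≤ ϑ / 2) (hm : 0 < m) (hmax : m ≤ max (Real.pi / 4 - ϑ) ρ) :
    ‖∫ x in Ioo (0 : ℝ) (Real.pi / 2), oscIntegrand K r β x‖ ≤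
      2 * (3 * ρ / √ϑ + 2 * ((4 + 2 * D 1) * (4 * √ϑ / (K * ρ * m)))) := by
  have hpi := Real.pi_pos
  obtain ⟨β', hd, hc', hV1, hV2⟩ := h.exists_deriv
  obtain ⟨hη, hη8, hC, h01, hz0, hz1, -, -⟩ := h
  have hsubr : ∀ x ∈ Icc 0 (Real.pi / 2), Real.pi / 2 - x ∈ Icc 0 (Real.pi / 2) := fun x hx =>
    ⟨by linarith [hx.2], by linarith [hx.1]⟩
  have habs : ∀ x ∈ Icc 0 (Real.pi / 2), |β x| ≤ 1 := fun x hx =>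
    abs_le.2 ⟨by linarith [(h01 x hx).1], (h01 x hx).2⟩
  have hq : Icc 0 (Real.pi / 4) ⊆ Icc 0 (Real.pi / 2) := Icc_subset_Icc le_rfl (by linarith)
  have hint : IntervalIntegrable (oscIntegrand K r β) volume 0 (Real.pi / 2) :=
    intervalIntegrable_oscIntegrand hη (by linarith) hC.continuousOn hz0 hz1
  have hint' : IntervalIntegrable (oscIntegrand K r fun y => β (Real.pi / 2 - y)) volume 0
      (Real.pi / 2) :=
    intervalIntegrable_oscIntegrand hη (by linarith)
      (hC.continuousOn.comp (by fun_prop) hsubr)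
      (fun x hx => hz1 _ ⟨by linarith [hx.2], by linarith [hx.1]⟩)
      (fun x hx => hz0 _ ⟨by linarith [hx.2], by linarith [hx.1]⟩)
  have hs1 : uIcc 0 (Real.pi / 4) ⊆ uIcc 0 (Real.pi / 2) := by
    rw [uIcc_of_le (by linarith), uIcc_of_le (by linarith)]; exact hq
  have hs2 : uIcc (Real.pi / 4) (Real.pi / 2) ⊆ uIcc 0 (Real.pi / 2) := by
    rw [uIcc_of_le (by linarith), uIcc_of_le (by linarith)]
    exact Icc_subset_Icc (by linarith) le_rfl
  have left := norm_half_integral_oscIntegrand_le hK hϑ0 hϑ hr hρ hρϑ hm hmax hη hd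
    (hc'.mono hq) (fun x hx => habs x (hq hx)) hz0 hV1 (hint.mono_set hs1)
  have right := norm_half_integral_oscIntegrand_le (b := fun y => β (Real.pi / 2 - y))
    (b' := fun y => -β' (Real.pi / 2 - y)) hK hϑ0 hϑ hr hρ hρϑ hm hmax hη
    (fun x hx => by
      have := (hd (Real.pi / 2 - x) ⟨by linarith [hx.2], by linarith [hx.1]⟩).comp x
        ((hasDerivAt_id x).const_sub (Real.pi / 2))
      simpa [Function.comp_def] using this)
    (((hc'.comp (by fun_prop) hsubr).mono hq).neg) (fun x hx => habs _ (hsubr x (hq hx)))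
    (fun x hx => hz1 _ ⟨by linarith [hx.2], by linarith [hx.1]⟩)
    (by simpa only [abs_neg] using hV2) (hint'.mono_set hs1)
  rw [← integral_Ioc_eq_integral_Ioo, ← intervalIntegral.integral_of_le (by linarith),
    ← intervalIntegral.integral_add_adjacent_intervals (hint.mono_set hs1) (hint.mono_set hs2)]
  refine (norm_add_le _ _).trans ?_
  rw [norm_integral_right_half_oscIntegrand]
  linarith

/-- Choice of the radius around the saddle point: of order `K ^ (-1/3)` in the transition range,
and of order `(ϑ / (K * (π / 4 - ϑ))) ^ (1/2)` otherwise. -/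
theorem exists_saddle_radius {K κ ϑ : ℝ} (hK : 3 ≤ K) (hκ : 0 < κ) (hKκ : K * κ ^ 3 = 1)
    (hϑ0 : 0 < ϑ) (hϑ : ϑ ≤ Real.pi / 4) (hKϑ : 2 ≤ K * ϑ) :
    ∃ ρ m T : ℝ, 0 < ρ ∧ ρ ≤ ϑ / 2 ∧ 0 < m ∧ m ≤ max (Real.pi / 4 - ϑ) ρ ∧
      ρ / √ϑ ≤ T ∧ √ϑ / (K * ρ * m) ≤ 1024 * T ∧
      ((Real.pi / 4 - ϑ < κ ∧ T = κ) ∨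
        (κ ≤ Real.pi / 4 - ϑ ∧ T = 1 / √(K * (Real.pi / 4 - ϑ)))) := by
  have hpi := Real.pi_gt_d2
  have hpi4 := Real.pi_le_four
  have hsϑ : 0 < √ϑ := Real.sqrt_pos.2 hϑ0
  have hκ1 : κ ≤ 0.694 := by
    by_contra! hc
    have h1 : (0.694 : ℝ) ^ 3 < κ ^ 3 := pow_lt_pow_left₀ hc (by norm_num) (by norm_num)
    nlinarith
  have hκK : 2 ≤ K * κ := by
    have h1 : κ ^ 2 ≤ 1 / 2 := by nlinarith
    have h2 : (K * κ) * κ ^ 2 = 1 := by rw [← hKκ]; ring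
    have h3 : 0 < K * κ := by positivity
    nlinarith
  rcases lt_or_ge (Real.pi / 4 - ϑ) κ with hτ | hτ
  · have hϑ1 : (0.09 : ℝ) ≤ ϑ := by linarith
    have hs1 : (0.3 : ℝ) ≤ √ϑ := Real.le_sqrt_of_sq_le (by norm_num; linarith)
    have hs2 : √ϑ ≤ 1 := Real.sqrt_le_one.2 (by linarith)
    refine ⟨κ / 32, κ / 32, κ, by positivity, by linarith, by positivity, le_max_right _ _, ?_, ?_,
      Or.inl ⟨hτ, rfl⟩⟩
    · rw [div_le_iff₀ hsϑ]; nlinarith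
    · rw [div_le_iff₀ (by positivity)]
      calc √ϑ ≤ K * κ ^ 3 := by rw [hKκ]; exact hs2
        _ = _ := by ring
  · have hτ0 : 0 < Real.pi / 4 - ϑ := hκ.trans_le hτ
    set τ := Real.pi / 4 - ϑ with hτdef
    have hKτ : 0 < K * τ := by positivity
    have hg : 0 < √(K * τ) := Real.sqrt_pos.2 hKτ
    have hgsq : √(K * τ) ^ 2 = K * τ := Real.sq_sqrt hKτ.le
    have hprod : 1 / 2 ≤ K * τ * ϑ := by
      rcases le_total ϑ (Real.pi / 8) with h | h
      · have : (0.3 : ℝ) ≤ τ := by linarith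
        nlinarith
      · have h1 : (0.3 : ℝ) ≤ ϑ := by linarith
        have h2 : K * κ ≤ K * τ := mul_le_mul_of_nonneg_left hτ (by linarith)
        nlinarith
    set g := √(K * τ)
    have hsq : √ϑ ^ 2 = ϑ := Real.sq_sqrt hϑ0.le
    refine ⟨√ϑ / (3 * g), τ, 1 / g, by positivity, ?_, hτ0, le_max_left _ _, ?_, ?_,
      Or.inr ⟨hτ, rfl⟩⟩
    · refine abs_le_of_sq_le_sq' ?_ (by positivity) |>.2
      rw [div_pow, mul_pow, hgsq, hsq, div_le_iff₀ (by positivity)]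
      nlinarith
    · rw [div_div, div_le_div_iff₀ (by positivity) hg]
      nlinarith [mul_pos hg hsϑ]
    · have : √ϑ / (K * (√ϑ / (3 * g)) * τ) = 3 * (1 / g) := by
        rw [div_eq_iff (by positivity)]
        field_simp
        rw [hgsq]
      rw [this]
      have : 0 < 1 / g := by positivity
      linarith

theorem rpow_neg_half_div_two_le {d t : ℝ} (hd : 0 < d) (ht : 0 < t) (h : d ≤ 2 * t ^ 2) :
    t ^ (-(1 : ℝ) / 2) / 2 ≤ d ^ (-(1 : ℝ) / 4) := by
  have h1 : d ≤ 16 * t ^ 2 := by nlinarith [sq_nonneg t]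
  refine le_trans (le_of_eq ?_) (Real.rpow_le_rpow_of_nonpos hd h1 (by norm_num))
  rw [Real.mul_rpow (by norm_num) (by positivity), ← Real.rpow_natCast t 2, ← Real.rpow_mul ht.le,
    show (16 : ℝ) = 2 ^ (4 : ℝ) by norm_num, ← Real.rpow_mul (by norm_num)]
  norm_num
  ring

theorem saddle_bound_le_two_mul {K κ r ϑ T : ℝ} (hK : 0 < K) (hκ : κ = K ^ (-(1 : ℝ) / 3))
    (hϑ : ϑ ≤ Real.pi / 4) (hr : 4 * r = K * Real.sin (2 * ϑ))
    (hT : (Real.pi / 4 - ϑ < κ ∧ T = κ) ∨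
        (κ ≤ Real.pi / 4 - ϑ ∧ T = 1 / √(K * (Real.pi / 4 - ϑ)))) :
    T ≤ 2 * (K ^ (-(1 : ℝ) / 3) * min 1 (if 4 * r = K then 1 else
      (1 - 4 * r / K) ^ (-(1 : ℝ) / 4) * K ^ (-(1 : ℝ) / 6))) := by
  have hκ0 : 0 < κ := by rw [hκ]; positivity
  have hτ0 : 0 ≤ Real.pi / 4 - ϑ := by linarith
  have hK6 : K ^ (-(1 : ℝ) / 6) = κ ^ ((1 : ℝ) / 2) := by
    rw [hκ, ← Real.rpow_mul hK.le]; norm_num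
  have hKκ : K * κ ^ 2 = κ⁻¹ := by
    rw [hκ, ← Real.rpow_natCast, ← Real.rpow_mul hK.le, ← Real.rpow_neg hK.le]
    nth_rewrite 1 [← Real.rpow_one K]
    rw [← Real.rpow_add hK]
    norm_num
  have hs : 4 * r / K = Real.sin (2 * ϑ) := by rw [hr]; field_simp
  have hΔ : 1 - 4 * r / K ≤ 2 * (Real.pi / 4 - ϑ) ^ 2 := by
    rw [hs, show 2 * ϑ = Real.pi / 2 - 2 * (Real.pi / 4 - ϑ) by ring, Real.sin_pi_div_two_sub]
    linarith [Real.one_sub_sq_div_two_le_cos (x := 2 * (Real.pi / 4 - ϑ))]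
  have hΔ0 : 4 * r ≠ K → 0 < 1 - 4 * r / K := by
    intro hne
    have h1 : 4 * r / K ≤ 1 := hs ▸ Real.sin_le_one _
    have h2 : 4 * r / K ≠ 1 := fun h => hne (by rwa [div_eq_one_iff_eq hK.ne'] at h)
    linarith [lt_of_le_of_ne h1 h2]
  rw [← hκ, hK6]
  rcases hT with ⟨hlt, rfl⟩ | ⟨hle, rfl⟩
  · have : (1 : ℝ) / 2 ≤ min 1 (if 4 * r = K then 1 else
        (1 - 4 * r / K) ^ (-(1 : ℝ) / 4) * T ^ ((1 : ℝ) / 2)) := by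
      refine le_min (by norm_num) ?_
      split_ifs with h
      · norm_num
      · have h1 := rpow_neg_half_div_two_le (hΔ0 h) hκ0 (hΔ.trans (by nlinarith))
        have h2 := mul_le_mul_of_nonneg_right h1 (Real.rpow_nonneg hκ0.le ((1 : ℝ) / 2))
        refine le_trans (le_of_eq ?_) h2
        rw [div_mul_eq_mul_div, ← Real.rpow_add hκ0]
        norm_num
    nlinarith
  · have hτ : 0 < Real.pi / 4 - ϑ := hκ0.trans_le hle
    generalize Real.pi / 4 - ϑ = τ at *
    have hle1 : 1 / √(K * τ) ≤ κ := by
      have h1 : κ⁻¹ ≤ √(K * τ) := by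
        apply Real.le_sqrt_of_sq_le
        calc κ⁻¹ ^ 2 = (K * κ ^ 2) * κ⁻¹ := by rw [hKκ]; ring
          _ = K * κ := by field_simp
          _ ≤ K * τ := mul_le_mul_of_nonneg_left hle hK.le
      rw [one_div]
      exact inv_le_of_inv_le₀ hκ0 h1
    rw [mul_min_of_nonneg _ _ hκ0.le, mul_min_of_nonneg _ _ (by norm_num : (0 : ℝ) ≤ 2), mul_one]
    refine le_min (by linarith) ?_
    split_ifs with h
    · linarith
    · have h1 := rpow_neg_half_div_two_le (hΔ0 h) hτ hΔ
      have h2 : κ * κ ^ ((1 : ℝ) / 2) = K ^ (-(1 : ℝ) / 2) := by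
        nth_rewrite 1 [← Real.rpow_one κ]
        rw [← Real.rpow_add hκ0, hκ, ← Real.rpow_mul hK.le]
        norm_num
      calc 1 / √(K * τ) = 2 * (τ ^ (-(1 : ℝ) / 2) / 2 * (κ * κ ^ ((1 : ℝ) / 2))) := by
            rw [h2, Real.sqrt_eq_rpow, one_div, ← Real.rpow_neg (by positivity),
              Real.mul_rpow hK.le hτ.le]
            norm_num
            ring
        _ ≤ 2 * ((1 - 4 * r / K) ^ (-(1 : ℝ) / 4) * (κ * κ ^ ((1 : ℝ) / 2))) := by gcongr
        _ = _ := by ring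

theorem statement15 (δ : ℝ) (hδ0 : 0 < δ) (hδ1 : δ < 1 / 4)
    (D : Fin 4 → ℝ) (hD : ∀ j, 0 < D j) :
    ∃ C : ℝ, 0 < C ∧ ∀ k : ℕ, 1 ≤ k → ∀ r : ℝ,
      (4 * (k : ℝ) - 1) ^ ((1 : ℝ) / 2 - δ) < r → r ≤ (4 * (k : ℝ) - 1) / 4 →
      ∀ β : ℝ → ℝ, IsCutoff D ((k : ℝ) ^ (-(1 : ℝ) / 2 - 2 * δ)) β →
        ‖∫ x in Ioo (0 : ℝ) (Real.pi / 2),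
            ((β x / Real.sqrt (Real.sin (2 * x)) : ℝ) : ℂ) *
              Complex.exp (Complex.I * (((4 * (k : ℝ) - 1) *
                (-x + 2 * r / (4 * (k : ℝ) - 1) * Real.log (Real.tan x)) : ℝ) : ℂ))‖ ≤
          C * ((4 * (k : ℝ) - 1) ^ (-(1 : ℝ) / 3) *
              min 1 (if 4 * r = 4 * (k : ℝ) - 1 then 1 else
                (1 - 4 * r / (4 * (k : ℝ) - 1)) ^ (-(1 : ℝ) / 4) *
                  (4 * (k : ℝ) - 1) ^ (-(1 : ℝ) / 6)) +
            (r * (4 * (k : ℝ) - 1)) ^ (-(1 : ℝ) / 2)) := by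
  have hD1 := hD 1
  refine ⟨4 * (3 + 8192 * (4 + 2 * D 1)), by positivity, fun k hk r hr1 hr2 β hβ => ?_⟩
  have hk' : (1 : ℝ) ≤ k := by exact_mod_cast hk
  have hK : (3 : ℝ) ≤ 4 * (k : ℝ) - 1 := by linarith
  generalize 4 * (k : ℝ) - 1 = K at *
  have hK0 : 0 < K := by linarith
  have hr : 1 ≤ r := (Real.one_le_rpow (by linarith) (by linarith)).trans hr1.le
  have hpi := Real.pi_pos
  have hq0 : 0 < 4 * r / K := by positivity
  have hq1 : 4 * r / K ≤ 1 := by rw [div_le_one hK0]; linarith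
  set ϑ := Real.arcsin (4 * r / K) / 2 with hϑdef
  have hsin : 4 * r = K * Real.sin (2 * ϑ) := by
    rw [hϑdef, mul_div_cancel₀ _ (two_ne_zero' ℝ), Real.sin_arcsin (by linarith) hq1]
    field_simp
  have hϑ0 : 0 < ϑ := half_pos (Real.arcsin_pos.2 hq0)
  have hϑ : ϑ ≤ Real.pi / 4 := by linarith [Real.arcsin_le_pi_div_two (4 * r / K)]
  have hKϑ : 2 ≤ K * ϑ := by
    have := mul_le_mul_of_nonneg_left (Real.sin_le (by linarith : 0 ≤ 2 * ϑ)) hK0.le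
    linarith
  have hKκ : K * (K ^ (-(1 : ℝ) / 3)) ^ 3 = 1 := by
    rw [← Real.rpow_natCast, ← Real.rpow_mul hK0.le]
    norm_num
    rw [Real.rpow_neg_one, mul_inv_cancel₀ hK0.ne']
  obtain ⟨ρ, m, T, hρ, hρϑ, hm, hmax, h1, h2, hT⟩ :=
    exists_saddle_radius hK (Real.rpow_pos_of_pos hK0 _) hKκ hϑ0 hϑ hKϑ
  have hle := saddle_bound_le_two_mul hK0 rfl hϑ hsin hT
  refine (hβ.norm_integral_oscIntegrand_le hK0 hϑ0 hϑ hsin hρ hρϑ hm hmax).trans ?_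
  set R := K ^ (-(1 : ℝ) / 3) * min 1 (if 4 * r = K then 1 else
      (1 - 4 * r / K) ^ (-(1 : ℝ) / 4) * K ^ (-(1 : ℝ) / 6))
  have hnn : 0 ≤ (r * K) ^ (-(1 : ℝ) / 2) := by positivity
  calc 2 * (3 * ρ / √ϑ + 2 * ((4 + 2 * D 1) * (4 * √ϑ / (K * ρ * m))))
      = 2 * (3 * (ρ / √ϑ) + 8 * (4 + 2 * D 1) * (√ϑ / (K * ρ * m))) := by ring
    _ ≤ 2 * (3 * T + 8 * (4 + 2 * D 1) * (1024 * T)) := by gcongr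
    _ = 2 * (3 + 8192 * (4 + 2 * D 1)) * T := by ring
    _ ≤ 2 * (3 + 8192 * (4 + 2 * D 1)) * (2 * (R + (r * K) ^ (-(1 : ℝ) / 2))) := by
        gcongr
        linarith
    _ = _ := by ring

end
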